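/- arXiv:0908.0477 — 3 statements merged into one kernel-verified Lean document; each statement's English description precedes it below -/
import Mathlib

section
/- If S = (s_1, s_2, …) is a sequence of integers each ≥ 2 all of which are odd, then the S-adic odometer (Z̃(S), +1̃) can be embedded in (X_glider, T̃²), the square of the gliders-with-reflecting-walls cellular automaton. -/
instance (n : ℕ) : TopologicalSpace (ZMod n) := ⊥
instance (n : ℕ) : DiscreteTopology (ZMod n) := ⟨rfl⟩

/-- `odProd S k = s₁ s₂ ⋯ s_{k+1}` (where `S i = s_{i+1}`, i.e. `S 0 = s₁`). -/
def odProd (S : ℕ → ℕ) (k : ℕ) : ℕ := ∏ i ∈ Finset.range (k + 1), S i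

theorem odProd_dvd (S : ℕ → ℕ) (k : ℕ) : odProd S k ∣ odProd S (k + 1) := by
  have h : odProd S (k + 1) = odProd S k * S (k + 1) := Finset.prod_range_succ S (k + 1)
  rw [h]
  exact dvd_mul_right _ _

/-- `Z̃(S)`: the inverse limit of the cyclic groups `ℤ/(s₁⋯s_k)ℤ` under the
binding maps `z ↦ z mod s₁⋯s_k`, with its profinite (subspace-of-product)
topology. -/
def OdometerSpace (S : ℕ → ℕ) : Type :=
  { z : (k : ℕ) → ZMod (odProd S k) //
      ∀ k, ZMod.castHom (odProd_dvd S k) (ZMod (odProd S k)) (z (k + 1)) = z k }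

instance (S : ℕ → ℕ) : TopologicalSpace (OdometerSpace S) :=
  inferInstanceAs (TopologicalSpace
    { z : (k : ℕ) → ZMod (odProd S k) //
        ∀ k, ZMod.castHom (odProd_dvd S k) (ZMod (odProd S k)) (z (k + 1)) = z k })

/-- The `+1̃` map on the odometer: add `1` in every coordinate. -/
def odometerAddOne (S : ℕ → ℕ) (z : OdometerSpace S) : OdometerSpace S :=
  ⟨fun k => z.1 k + 1, fun k => by rw [map_add, map_one, z.2 k]⟩

/-- The alphabet `{W, L, R, ∅}` of the gliders-with-reflecting-walls CA
(`E` denotes the empty cell `∅`). -/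
inductive GSym : Type
  | W : GSym
  | L : GSym
  | R : GSym
  | E : GSym
  deriving DecidableEq

instance : TopologicalSpace GSym := ⊥
instance : DiscreteTopology GSym := ⟨rfl⟩

/-- The gliders-with-reflecting-walls map `T̃` (cells indexed by ℕ, cell 0
being the leftmost cell): walls do not move; an `L` with `∅` immediately to
its left swaps places with it, and an `L` with `W` immediately to its left
becomes `R` without moving; an `R` with `∅` immediately to its right swaps
places with it, and an `R` with `W` immediately to its right becomes `L`
without moving. -/
def gliderStep (x : ℕ → GSym) : ℕ → GSym := fun i =>
  match x i with
  | GSym.W => GSym.W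
  | GSym.L => if x (i - 1) = GSym.W then GSym.R else GSym.E
  | GSym.R => if x (i + 1) = GSym.W then GSym.L else GSym.E
  | GSym.E =>
      if x (i + 1) = GSym.L then GSym.L
      else if x (i - 1) = GSym.R then GSym.R
      else GSym.E

/-- The glider state space `X_glider`: the first cell is a wall, there are
infinitely many walls, and strictly between any two consecutive walls there is
exactly one particle (`L` or `R`), all other cells there being empty. -/
def XGlider : Set (ℕ → GSym) :=
  { x | x 0 = GSym.W ∧ (∀ N : ℕ, ∃ i, N ≤ i ∧ x i = GSym.W) ∧
      ∀ i j : ℕ, i < j → x i = GSym.W → x j = GSym.W →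
        (∀ k, i < k → k < j → x k ≠ GSym.W) →
        ∃! k, i < k ∧ k < j ∧ (x k = GSym.L ∨ x k = GSym.R) }

/-- The symbol in cell `j` of a wall followed by `p` cells, when the particle in these cells is in
state `s < 2 * p`: cell `0` is the wall, the states `0, …, p - 1` are a particle moving right
through the cells `1, …, p`, and the states `p, …, 2 * p - 1` are a particle moving left through
the cells `p, …, 1`. -/
def blockSymbol (p s j : ℕ) : GSym :=
  if j = 0 then GSym.W
  else if s + 1 = j then GSym.R
  else if s + j = 2 * p then GSym.L
  else GSym.E

/-- The successor modulo `n` on `{0, …, n - 1}`. -/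
def cyclicSucc (n s : ℕ) : ℕ := if s + 1 = n then 0 else s + 1

/-- The block containing the cell `i`, and the place of the cell in this block, when block `k`
consists of a wall followed by `p k` cells. -/
def blockIndex (p : ℕ → ℕ) : ℕ → ℕ × ℕ
  | 0 => (0, 0)
  | i + 1 => if (blockIndex p i).2 = p (blockIndex p i).1 then ((blockIndex p i).1 + 1, 0)
      else ((blockIndex p i).1, (blockIndex p i).2 + 1)

/-- The position of the wall of block `k`. -/
def wallPos (p : ℕ → ℕ) (k : ℕ) : ℕ := ∑ i ∈ Finset.range k, (p i + 1)

/-- The configuration whose particle in block `k` is in state `s k`. -/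
def gliderConfig (p s : ℕ → ℕ) (i : ℕ) : GSym :=
  blockSymbol (p (blockIndex p i).1) (s (blockIndex p i).1) (blockIndex p i).2

theorem wallPos_succ (p : ℕ → ℕ) (k : ℕ) : wallPos p (k + 1) = wallPos p k + (p k + 1) :=
  Finset.sum_range_succ _ _

theorem le_wallPos (p : ℕ → ℕ) (k : ℕ) : k ≤ wallPos p k := by
  induction k with
  | zero => exact Nat.zero_le _
  | succ k ih => rw [wallPos_succ]; omega

theorem blockIndex_add (p : ℕ → ℕ) (i j : ℕ) (h : (blockIndex p i).2 = 0)
    (hj : j ≤ p (blockIndex p i).1) : blockIndex p (i + j) = ((blockIndex p i).1, j) := by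
  induction j with
  | zero => exact Prod.ext rfl h
  | succ j ih =>
    rw [← add_assoc, blockIndex, ih (by omega), if_neg (by simp only; omega)]

theorem blockIndex_wallPos (p : ℕ → ℕ) (k : ℕ) : blockIndex p (wallPos p k) = (k, 0) := by
  induction k with
  | zero => rfl
  | succ k ih =>
    have h := blockIndex_add p (wallPos p k) (p k) (by rw [ih]) (by rw [ih])
    rw [wallPos_succ, ← add_assoc, blockIndex, h, ih]
    simp

theorem blockIndex_wallPos_add (p : ℕ → ℕ) {k j : ℕ} (hj : j ≤ p k) :
    blockIndex p (wallPos p k + j) = (k, j) := by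
  have h := blockIndex_wallPos p k
  simpa [h] using blockIndex_add p (wallPos p k) j (by rw [h]) (by rwa [h])

theorem exists_eq_wallPos_add (p : ℕ → ℕ) (i : ℕ) : ∃ k j, j ≤ p k ∧ i = wallPos p k + j := by
  induction i with
  | zero => exact ⟨0, 0, Nat.zero_le _, rfl⟩
  | succ i ih =>
    obtain ⟨k, j, hj, rfl⟩ := ih
    rcases hj.lt_or_eq with hlt | rfl
    · exact ⟨k, j + 1, hlt, rfl⟩
    · exact ⟨k + 1, 0, Nat.zero_le _, by rw [wallPos_succ]; rfl⟩

theorem gliderConfig_wallPos_add (p s : ℕ → ℕ) {k j : ℕ} (hj : j ≤ p k) :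
    gliderConfig p s (wallPos p k + j) = blockSymbol (p k) (s k) j := by
  rw [gliderConfig, blockIndex_wallPos_add p hj]

theorem gliderConfig_wallPos (p s : ℕ → ℕ) (k : ℕ) :
    gliderConfig p s (wallPos p k) = GSym.W :=
  gliderConfig_wallPos_add p s (Nat.zero_le (p k))

theorem blockSymbol_eq_W_iff {p s j : ℕ} : blockSymbol p s j = GSym.W ↔ j = 0 := by
  unfold blockSymbol
  split_ifs <;> simp_all

theorem blockSymbol_eq_L_or_R_iff {p s j : ℕ} (hs : s < 2 * p) (hj0 : 0 < j) (hj : j ≤ p) :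
    blockSymbol p s j = GSym.L ∨ blockSymbol p s j = GSym.R ↔
      j = if s < p then s + 1 else 2 * p - s := by
  unfold blockSymbol
  split_ifs <;> simp <;> omega

theorem state_eq_of_blockSymbol_eq {p s t : ℕ} (hs : s < 2 * p)
    (h : ∀ j ≤ p, blockSymbol p s j = blockSymbol p t j) : s = t := by
  by_cases hsp : s < p
  · have := h (s + 1) hsp
    unfold blockSymbol at this
    split_ifs at this <;> simp_all
  · have := h (2 * p - s) (by omega)
    unfold blockSymbol at this
    split_ifs at this <;> omega

theorem gliderStep_of_blockSymbol {x : ℕ → GSym} {i p s j : ℕ} (hs : s < 2 * p) (hj0 : 0 < j)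
    (hj : j ≤ p) (hpred : x (i - 1) = blockSymbol p s (j - 1)) (hx : x i = blockSymbol p s j)
    (hsucc : x (i + 1) = if j = p then GSym.W else blockSymbol p s (j + 1)) :
    gliderStep x i = blockSymbol p (cyclicSucc (2 * p) s) j := by
  unfold gliderStep
  rw [hpred, hx, hsucc]
  unfold blockSymbol cyclicSucc
  by_cases h1 : s + 1 = j
  · grind
  by_cases h2 : s + j = 2 * p
  · grind
  · simp only [hj0.ne', h1, h2, if_false]
    grind

theorem gliderStep_gliderConfig {p s : ℕ → ℕ} (hs : ∀ k, s k < 2 * p k) :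
    gliderStep (gliderConfig p s) = gliderConfig p (fun k => cyclicSucc (2 * p k) (s k)) := by
  funext i
  obtain ⟨k, j, hj, rfl⟩ := exists_eq_wallPos_add p i
  rw [gliderConfig_wallPos_add p _ hj]
  rcases Nat.eq_zero_or_pos j with rfl | hj0
  · simp [gliderStep, gliderConfig_wallPos, blockSymbol]
  · refine gliderStep_of_blockSymbol (hs k) hj0 hj ?_ (gliderConfig_wallPos_add p s hj) ?_
    · rw [Nat.add_sub_assoc hj0]
      exact gliderConfig_wallPos_add p s (by omega)
    · split_ifs with h
      · rw [h, add_assoc, ← wallPos_succ, gliderConfig_wallPos]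
      · rw [add_assoc]
        exact gliderConfig_wallPos_add p s (by omega)

theorem gliderConfig_mem_XGlider {p s : ℕ → ℕ} (hs : ∀ k, s k < 2 * p k) :
    gliderConfig p s ∈ XGlider := by
  refine ⟨gliderConfig_wallPos p s 0,
    fun N => ⟨wallPos p N, le_wallPos p N, gliderConfig_wallPos p s N⟩, ?_⟩
  intro i j hij hi hj hbetween
  obtain ⟨k, a, ha, rfl⟩ := exists_eq_wallPos_add p i
  rw [gliderConfig_wallPos_add p s ha, blockSymbol_eq_W_iff] at hi
  subst hi
  rw [add_zero] at hij hbetween ⊢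
  have hwall := wallPos_succ p k
  obtain rfl : j = wallPos p (k + 1) := by
    rcases lt_trichotomy j (wallPos p (k + 1)) with h | h | h
    · obtain ⟨b, rfl⟩ := Nat.exists_eq_add_of_lt hij
      rw [add_assoc, gliderConfig_wallPos_add p s (by omega), blockSymbol_eq_W_iff] at hj
      omega
    · exact h
    · exact absurd (gliderConfig_wallPos p s (k + 1)) (hbetween _ (by omega) h)
  have hk := hs k
  have hpos : 0 < (if s k < p k then s k + 1 else 2 * p k - s k) ∧
      (if s k < p k then s k + 1 else 2 * p k - s k) ≤ p k := by
    split_ifs <;> omega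
  refine ⟨wallPos p k + (if s k < p k then s k + 1 else 2 * p k - s k),
    ⟨by omega, by omega, ?_⟩, ?_⟩
  · rw [gliderConfig_wallPos_add p s hpos.2]
    exact (blockSymbol_eq_L_or_R_iff hk hpos.1 hpos.2).2 rfl
  · rintro n ⟨hn, hn', hsym⟩
    obtain ⟨b, rfl⟩ := Nat.exists_eq_add_of_lt hn
    rw [add_assoc] at hsym ⊢
    rw [gliderConfig_wallPos_add p s (by omega)] at hsym
    rw [(blockSymbol_eq_L_or_R_iff hk (by omega) (by omega)).1 hsym]

theorem ZMod.val_add_one_eq_cyclicSucc {n : ℕ} [NeZero n] (z : ZMod n) :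
    (z + 1).val = cyclicSucc n z.val := by
  have hz := z.val_lt
  rw [ZMod.val_add, ZMod.val_one_eq_one_mod, Nat.add_mod_mod, cyclicSucc]
  split_ifs with h
  · rw [h, Nat.mod_self]
  · exact Nat.mod_eq_of_lt (by omega)

theorem cyclicSucc_cyclicSucc_two_mul {n s : ℕ} :
    cyclicSucc (2 * n) (cyclicSucc (2 * n) (2 * s)) = 2 * cyclicSucc n s := by
  unfold cyclicSucc
  split_ifs <;> omega

theorem cyclicSucc_lt {n s : ℕ} (hs : s < n) : cyclicSucc n s < n := by
  unfold cyclicSucc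
  split_ifs <;> omega

theorem gliderStep_sq_gliderConfig {p v : ℕ → ℕ} (hv : ∀ k, v k < p k) :
    gliderStep^[2] (gliderConfig p fun k => 2 * v k) =
      gliderConfig p fun k => 2 * cyclicSucc (p k) (v k) := by
  have hs : ∀ k, 2 * v k < 2 * p k := fun k => by have := hv k; omega
  rw [Function.iterate_succ_apply, Function.iterate_one, gliderStep_gliderConfig hs,
    gliderStep_gliderConfig fun k => cyclicSucc_lt (hs k)]
  simp only [cyclicSucc_cyclicSucc_two_mul]

theorem compactSpace_odometerSpace (S : ℕ → ℕ) [∀ k, NeZero (odProd S k)] :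
    CompactSpace (OdometerSpace S) := by
  have : IsClosed { z : (k : ℕ) → ZMod (odProd S k) |
      ∀ k, ZMod.castHom (odProd_dvd S k) (ZMod (odProd S k)) (z (k + 1)) = z k } := by
    rw [Set.ofPred_forall]
    exact isClosed_iInter fun k => isClosed_eq
      (continuous_of_discreteTopology.comp (continuous_apply (k + 1))) (continuous_apply k)
  exact isCompact_iff_compactSpace.1 this.isCompact

/-- The configuration coding a point `z` of the odometer: block `k` has `odProd S k` cells after
its wall, and the particle in it is in the state `2 * z k`. -/
def odometerConfig (S : ℕ → ℕ) (z : OdometerSpace S) : ℕ → GSym :=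
  gliderConfig (odProd S) fun k => 2 * (z.1 k).val

theorem continuous_odometerConfig (S : ℕ → ℕ) : Continuous (odometerConfig S) :=
  continuous_pi fun i =>
    (continuous_of_discreteTopology (f := fun a : ZMod (odProd S (blockIndex (odProd S) i).1) =>
      blockSymbol (odProd S (blockIndex (odProd S) i).1) (2 * a.val)
        (blockIndex (odProd S) i).2)).comp
      ((continuous_apply _).comp continuous_subtype_val)

theorem injective_odometerConfig (S : ℕ → ℕ) [∀ k, NeZero (odProd S k)] :
    Function.Injective (odometerConfig S) := by
  intro z z' h
  refine Subtype.ext (funext fun k => ZMod.val_injective _ ?_)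
  have hlt := (z.1 k).val_lt
  have : 2 * (z.1 k).val = 2 * (z'.1 k).val := by
    refine state_eq_of_blockSymbol_eq (p := odProd S k) (by omega) fun j hj => ?_
    have hcell := congrFun h (wallPos (odProd S) k + j)
    rwa [odometerConfig, odometerConfig, gliderConfig_wallPos_add _ _ hj,
      gliderConfig_wallPos_add _ _ hj] at hcell
  omega

theorem odometerConfig_odometerAddOne (S : ℕ → ℕ) [∀ k, NeZero (odProd S k)]
    (z : OdometerSpace S) :
    odometerConfig S (odometerAddOne S z) = gliderStep^[2] (odometerConfig S z) := by
  rw [odometerConfig, odometerConfig, gliderStep_sq_gliderConfig fun k => (z.1 k).val_lt]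
  simp only [odometerAddOne, ZMod.val_add_one_eq_cyclicSucc]

/-- If all the `sᵢ` are odd, the `S`-adic odometer can be embedded in
`(X_glider, T̃²)`, the square of the gliders-with-reflecting-walls cellular
automaton. -/
theorem odometer_embeds_in_glider_sq_of_all_odd (S : ℕ → ℕ) (hS : ∀ k, 2 ≤ S k)
    (hodd : ∀ k, Odd (S k)) :
    ∃ Y : Set (ℕ → GSym), Y ⊆ XGlider ∧ IsClosed Y ∧
      Set.MapsTo (gliderStep^[2]) Y Y ∧
      ∃ h : OdometerSpace S ≃ₜ Y,
        ∀ z, (h (odometerAddOne S z) : ℕ → GSym) = gliderStep^[2] (h z) := by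
  have hne : ∀ k, NeZero (odProd S k) := fun k =>
    ⟨Finset.prod_ne_zero_iff.2 fun i _ => by have := hS i; omega⟩
  have := compactSpace_odometerSpace S
  have hemb := (continuous_odometerConfig S).isClosedEmbedding (injective_odometerConfig S)
  refine ⟨Set.range (odometerConfig S), ?_, hemb.isClosed_range, ?_,
    hemb.isEmbedding.toHomeomorph, odometerConfig_odometerAddOne S⟩
  · rintro _ ⟨z, rfl⟩
    refine gliderConfig_mem_XGlider fun k => ?_
    have := (z.1 k).val_lt
    omega
  · rintro _ ⟨z, rfl⟩
    exact ⟨odometerAddOne S z, odometerConfig_odometerAddOne S z⟩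
end

section
/- Let S = (s_1, s_2, …) be a sequence of integers each ≥ 2 and let n ≥ 2. If the S-adic odometer (Z̃(S), +1̃) can be embedded in the two-sided cellular automaton ((ℤ/nℤ)^ℤ, T_n), then the set of prime divisors of the members of S is finite. -/
/-- The two-sided cellular automaton `T_n` on `(ℤ/nℤ)^ℤ` with local rule
`xᵢ ↦ xᵢ + xᵢ₊₁ (mod n)`. -/
def Tca (n : ℕ) (x : ℤ → ZMod n) : ℤ → ZMod n := fun i => x i + x (i + 1)

/-- On a compact space, a continuous function to a discrete space is determined by finitely many
members of any point-separating family of continuous functions to discrete spaces. -/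
theorem exists_finset_forall_eq_of_separating {X ι D : Type*} {A : ι → Type*}
    [TopologicalSpace X] [CompactSpace X] [TopologicalSpace D] [DiscreteTopology D]
    [∀ i, TopologicalSpace (A i)] [∀ i, DiscreteTopology (A i)]
    {g : ∀ i, X → A i} (hg : ∀ i, Continuous (g i))
    (hsep : ∀ x y, (∀ i, g i x = g i y) → x = y) {f : X → D} (hf : Continuous f) :
    ∃ s : Finset ι, ∀ x y, (∀ i ∈ s, g i x = g i y) → f x = f y := by
  have hne : IsClosed {q : X × X | f q.1 ≠ f q.2} :=
    (isClosed_discrete {d : D × D | d.1 ≠ d.2}).preimage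
      ((hf.comp continuous_fst).prodMk (hf.comp continuous_snd))
  obtain ⟨s, hs⟩ := hne.isCompact.elim_finite_subfamily_closed
    (fun i => {q : X × X | g i q.1 = g i q.2})
    (fun i => isClosed_eq ((hg i).comp continuous_fst) ((hg i).comp continuous_snd))
    (by
      ext ⟨x, y⟩
      simp only [Set.mem_inter_iff, Set.mem_ofPred_eq, Set.mem_iInter, Set.mem_empty_iff_false,
        iff_false, not_and]
      exact fun hxy h => hxy (congrArg f (hsep x y h)))
  refine ⟨s, fun x y h => ?_⟩
  by_contra hxy
  have hmem : (x, y) ∈ {q : X × X | f q.1 ≠ f q.2} ∩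
      ⋂ i ∈ s, {q : X × X | g i q.1 = g i q.2} :=
    ⟨hxy, Set.mem_iInter₂.2 h⟩
  rw [hs] at hmem
  exact hmem

theorem iterate_mul_invariant {X B : Type*} {T : X → X} {u : X → B} {p : ℕ}
    (hu : ∀ z, u (T^[p] z) = u z) (m : ℕ) (z : X) : u (T^[p * m] z) = u z := by
  induction m generalizing z with
  | zero => rfl
  | succ m ih => rw [Nat.mul_succ, Function.iterate_add_apply, ih, hu]

/-- If the increment of `u` along `T` is `T^[p]`-invariant, then `u` is `T^[p * n]`-invariant
when its values are integers modulo `n`. -/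
theorem iterate_mul_invariant_of_increment {X : Type*} {T : X → X} {n p : ℕ} {u v : X → ZMod n}
    (huv : ∀ z, u (T z) = u z + v z) (hv : ∀ z, v (T^[p] z) = v z) (z : X) :
    u (T^[p * n] z) = u z := by
  have hstep : ∀ z, u (T^[p] (T z)) - u (T z) = u (T^[p] z) - u z := fun z => by
    rw [Function.Commute.iterate_self T p z, huv, huv, hv]
    ring
  have hiter : ∀ k z, u (T^[p] (T^[k] z)) - u (T^[k] z) = u (T^[p] z) - u z := by
    intro k
    induction k with
    | zero => exact fun z => rfl
    | succ k ih => intro z; rw [Function.iterate_succ_apply, ih, hstep]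
  have hmul : ∀ m : ℕ, u (T^[p * m] z) = u z + m * (u (T^[p] z) - u z) := by
    intro m
    induction m with
    | zero => simp
    | succ m ih =>
      have h := hiter (p * m) z
      rw [Nat.mul_succ, Nat.add_comm, Function.iterate_add_apply, sub_eq_iff_eq_add.1 h, ih]
      push_cast
      ring
  simpa using hmul n

/-- If coordinate `0` is invariant under `T^[p]`, then every coordinate of a semiconjugacy to
`Tca n` is invariant under `T^[p * n ^ e]` for some `e`. -/
theorem exists_iterate_invariant {X : Type*} {T : X → X} {n p : ℕ} {u : X → ℤ → ZMod n}
    (hu : ∀ z, u (T z) = Tca n (u z)) (h0 : ∀ z, u (T^[p] z) 0 = u z 0) (i : ℤ) :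
    ∃ e, ∀ z, u (T^[p * n ^ e] z) i = u z i := by
  have hstep : ∀ i z, u (T z) i = u z i + u z (i + 1) := fun i z => by rw [hu]; rfl
  induction i using Int.induction_on with
  | zero => exact ⟨0, by simpa using h0⟩
  | succ i ih =>
    obtain ⟨e, he⟩ := ih
    refine ⟨e, fun z => ?_⟩
    have hz := hstep i (T^[p * n ^ e] z)
    rw [← Function.Commute.iterate_self T, he, he, hstep] at hz
    exact (add_left_cancel hz).symm
  | pred i ih =>
    obtain ⟨e, he⟩ := ih
    refine ⟨e + 1, fun z => ?_⟩
    rw [pow_succ, ← mul_assoc]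
    refine iterate_mul_invariant_of_increment (u := fun z => u z (-i - 1)) (fun z => hstep _ z)
      (fun z => ?_) z
    simpa using he z

theorem odometerAddOne_iterate_val (S : ℕ → ℕ) (m k : ℕ) (z : OdometerSpace S) :
    ((odometerAddOne S)^[m] z).1 k = z.1 k + m := by
  induction m generalizing z with
  | zero => simp
  | succ m ih =>
    rw [Function.iterate_succ_apply, ih]
    change z.1 k + 1 + (m : ZMod (odProd S k)) = _
    push_cast
    ring

theorem continuous_odometer_val (S : ℕ → ℕ) (k : ℕ) :
    Continuous fun z : OdometerSpace S => z.1 k :=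
  (continuous_apply k).comp continuous_subtype_val

/-- If the `S`-adic odometer can be embedded in `((ℤ/nℤ)^ℤ, T_n)` for some
`n ≥ 2`, then the set of prime divisors of the members of `S` is finite. -/
theorem finitary_of_embeds (S : ℕ → ℕ) (hS : ∀ k, 2 ≤ S k) (n : ℕ) (hn : 2 ≤ n)
    (hemb : ∃ Y : Set (ℤ → ZMod n), IsClosed Y ∧ Set.MapsTo (Tca n) Y Y ∧
      ∃ h : OdometerSpace S ≃ₜ Y,
        ∀ z, (h (odometerAddOne S z) : ℤ → ZMod n) = Tca n (h z)) :
    {p : ℕ | p.Prime ∧ ∃ k, p ∣ S k}.Finite := by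
  obtain ⟨Y, hY, -, h, hconj⟩ := hemb
  have : NeZero n := ⟨by omega⟩
  have : CompactSpace Y := isCompact_iff_compactSpace.1 hY.isCompact
  have : CompactSpace (OdometerSpace S) := h.symm.compactSpace
  have hcont : ∀ i : ℤ, Continuous fun z => (h z : ℤ → ZMod n) i := fun i =>
    (continuous_apply i).comp (continuous_subtype_val.comp h.continuous)
  obtain ⟨s, hs⟩ := exists_finset_forall_eq_of_separating (continuous_odometer_val S)
    (fun x y hxy => Subtype.ext (funext hxy)) (hcont 0)
  set p := ∏ k ∈ s, odProd S k
  have hp0 : p ≠ 0 := Finset.prod_ne_zero_iff.2 fun k _ =>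
    Finset.prod_ne_zero_iff.2 fun i _ => by have := hS i; omega
  have hcol : ∀ z, (h ((odometerAddOne S)^[p] z) : ℤ → ZMod n) 0 = (h z : ℤ → ZMod n) 0 :=
    fun z => hs _ _ fun k hk => by
      rw [odometerAddOne_iterate_val, (ZMod.natCast_eq_zero_iff _ _).2 (Finset.dvd_prod_of_mem _ hk),
        add_zero]
  choose e he using exists_iterate_invariant (u := fun z => (h z : ℤ → ZMod n)) hconj hcol
  refine (p * n).primeFactors.finite_toSet.subset ?_
  rintro q ⟨hq, K, hqK⟩
  have z : OdometerSpace S := ⟨0, fun k => map_zero _⟩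
  obtain ⟨t, ht⟩ := exists_finset_forall_eq_of_separating hcont
    (fun x y hxy => h.injective (Subtype.ext (funext hxy))) (continuous_odometer_val S K)
  have hinv := ht ((odometerAddOne S)^[p * n ^ ∑ i ∈ t, e i] z) z fun i hi => by
      obtain ⟨m, hm⟩ : p * n ^ e i ∣ p * n ^ ∑ i ∈ t, e i :=
        mul_dvd_mul_left _ (pow_dvd_pow _ (Finset.single_le_sum (fun _ _ => Nat.zero_le _) hi))
      rw [hm]
      exact iterate_mul_invariant (u := fun z => (h z : ℤ → ZMod n) i) (he i) m _
  rw [odometerAddOne_iterate_val, add_eq_left, ZMod.natCast_eq_zero_iff] at hinv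
  have hqd : q ∣ p * n ^ ∑ i ∈ t, e i :=
    (hqK.trans (Finset.dvd_prod_of_mem S (Finset.self_mem_range_succ K))).trans hinv
  have hpn : q ∣ p * n := by
    rcases hq.dvd_mul.1 hqd with hd | hd
    · exact hd.mul_right n
    · exact (hq.dvd_of_dvd_pow hd).mul_left p
  exact Nat.mem_primeFactors.2 ⟨hq, hpn, mul_ne_zero hp0 (NeZero.ne n)⟩
end

section
/- Let n ≥ 2 and let x ∈ (ℤ/nℤ)^ℤ be such that for every i ∈ ℤ, column i of the space-time diagram of T_n with seed x is periodic. Then the set of primes p such that p divides the least period of some column of this space-time diagram is finite. -/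
/-- Column `i` of the space-time diagram of `T_n` with seed `x`:
`j ↦ [T_n^j(x)]_i`. -/
def col (n : ℕ) (x : ℤ → ZMod n) (i : ℤ) : ℕ → ZMod n := fun j => (Tca n)^[j] x i

/-- A sequence `f : ℕ → α` is periodic with least period `m`. -/
def HasLeastPeriod {α : Type*} (f : ℕ → α) (m : ℕ) : Prop :=
  0 < m ∧ (∀ j, f (j + m) = f j) ∧ ∀ m', 0 < m' → (∀ j, f (j + m') = f j) → m ≤ m'

theorem col_succ (n : ℕ) (x : ℤ → ZMod n) (i : ℤ) (j : ℕ) :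
    col n x i (j + 1) = col n x i j + col n x (i + 1) j := by
  simp only [col, Function.iterate_succ_apply', Tca]

theorem HasLeastPeriod.dvd {α : Type*} {f : ℕ → α} {m M : ℕ} (h : HasLeastPeriod f m)
    (hM : Function.Periodic f M) : m ∣ M := by
  obtain ⟨hm, hper, hmin⟩ := h
  by_contra hdvd
  refine absurd (hmin (M % m) (Nat.pos_of_ne_zero fun h0 => hdvd (Nat.dvd_of_mod_eq_zero h0))
    fun j => ?_) (Nat.mod_lt M hm).not_ge
  have hmul : Function.Periodic f (M / m * m) := by
    simpa using Function.Periodic.nsmul (show Function.Periodic f m from hper) (M / m)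
  rw [← hmul (j + M % m), add_assoc, Nat.mod_add_div', hM j]

theorem periodic_col_add_one {n : ℕ} {x : ℤ → ZMod n} {i : ℤ} {m : ℕ}
    (h : Function.Periodic (col n x i) m) : Function.Periodic (col n x (i + 1)) m := by
  intro j
  have h₁ := col_succ n x i (j + m)
  rw [add_right_comm, h, h, col_succ] at h₁
  exact (add_left_cancel h₁).symm

theorem periodic_col_of_add_one {n : ℕ} {x : ℤ → ZMod n} {i : ℤ} {m : ℕ}
    (h : Function.Periodic (col n x (i + 1)) m) : Function.Periodic (col n x i) (m * n) := by
  have hconst : ∀ j, col n x i (j + m) = col n x i j + (col n x i m - col n x i 0) := by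
    intro j
    induction j with
    | zero => simp
    | succ j ih => rw [add_right_comm, col_succ, ih, h, col_succ]; ring
  have hmul : ∀ k j : ℕ,
      col n x i (j + m * k) = col n x i j + k * (col n x i m - col n x i 0) := by
    intro k j
    induction k with
    | zero => simp
    | succ k ih => rw [mul_add_one, ← add_assoc, hconst, ih]; push_cast; ring
  intro j
  simp [hmul]

theorem exists_periodic_col {n : ℕ} {x : ℤ → ZMod n} {m : ℕ}
    (h : Function.Periodic (col n x 0) m) (i : ℤ) :
    ∃ k : ℕ, Function.Periodic (col n x i) (m * n ^ k) := by
  induction i with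
  | zero => exact ⟨0, by simpa using h⟩
  | succ i ih => exact ih.imp fun _ => periodic_col_add_one
  | pred i ih =>
    obtain ⟨k, hk⟩ := ih
    refine ⟨k + 1, ?_⟩
    rw [pow_succ, ← mul_assoc]
    exact periodic_col_of_add_one (by simpa using hk)

/-- If every column of the space-time diagram of `T_n` with seed `x` is
periodic, then the set of primes dividing the least period of some column is
finite. -/
theorem primes_dividing_column_periods_finite (n : ℕ) (hn : 2 ≤ n)
    (x : ℤ → ZMod n)
    (hx : ∀ i : ℤ, ∃ m, 0 < m ∧ ∀ j, col n x i (j + m) = col n x i j) :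
    {p : ℕ | p.Prime ∧ ∃ (i : ℤ) (m : ℕ),
      HasLeastPeriod (col n x i) m ∧ p ∣ m}.Finite := by
  obtain ⟨m₀, hm₀, h₀⟩ := hx 0
  refine (Set.finite_Iic (m₀ * n)).subset ?_
  rintro p ⟨hp, i, m, hm, hpm⟩
  obtain ⟨k, hk⟩ := exists_periodic_col h₀ i
  refine Nat.le_of_dvd (by positivity) ?_
  rcases hp.dvd_mul.1 (hpm.trans (hm.dvd hk)) with hdvd | hdvd
  · exact hdvd.mul_right n
  · exact (hp.dvd_of_dvd_pow hdvd).mul_left m₀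
end
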